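/- arXiv:math/0603111 — 2 statements merged into one kernel-verified Lean document; each statement's English description precedes it below -/
import Mathlib

section
/- In Pic(S_8) ≅ ℤ^9, there are exactly 240 (2)-rulings, i.e., classes D_1 + D_2 with D_1, D_2 (-1)-classes and D_1·D_2 = 2; they are exactly the classes -K + D for D a (-1)-class, and each admits exactly 28 unordered representations as a sum of two (-1)-classes. -/
open Finset

/-- Intersection form on Pic = ℤ^9 with matrix diag(1,-1,...,-1). -/
def dot (x y : Fin 9 → ℤ) : ℤ := x 0 * y 0 - ∑ i : Fin 8, x i.succ * y i.succ

/-- The canonical class K = (-3,1,...,1). -/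
def K : Fin 9 → ℤ := fun i => if i = 0 then -3 else 1

/-- A (-1)-class: D·D = -1 and D·K = -1. -/
def isNegClass (D : Fin 9 → ℤ) : Prop := dot D D = -1 ∧ dot D K = -1

/-- A (2)-ruling: a sum of two (-1)-classes with intersection number 2. -/
def IsTwoRuling (R : Fin 9 → ℤ) : Prop :=
  ∃ D1 D2, isNegClass D1 ∧ isNegClass D2 ∧ dot D1 D2 = 2 ∧ R = D1 + D2

/-- The integer lists of length `n` with sum `s`, sum of squares `q` and entries in `[-3, 1]`. -/
def boundedLists : ℕ → ℤ → ℤ → List (List ℤ)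
  | 0, s, q => if s = 0 ∧ q = 0 then [[]] else []
  | n + 1, s, q =>
    if s * s ≤ (n + 1) * q then
      [-3, -2, -1, 0, 1].flatMap fun a =>
        (boundedLists n (s - a) (q - a * a)).map (List.cons a)
    else []

/-- The coordinate lists of the `(-1)`-classes. -/
def negLists : List (List ℤ) :=
  [-1, 0, 1, 2, 3, 4, 5, 6, 7].flatMap fun d =>
    (boundedLists 8 (1 - 3 * d) (d * d + 1)).map (List.cons d)

/-- The sum of the products of corresponding entries. -/
def mulSum : List ℤ → List ℤ → ℤ
  | a :: l, b :: m => a * b + mulSum l m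
  | _, _ => 0

/-- The intersection form on coordinate lists. -/
def listDot : List ℤ → List ℤ → ℤ
  | a :: l, b :: m => a * b - mulSum l m
  | _, _ => 0

theorem length_negLists : negLists.length = 240 := by decide +kernel

theorem countP_negLists_of_sorted :
    ∀ l ∈ negLists, l.tail.Pairwise (· ≤ ·) →
      negLists.countP (fun m => listDot l m = 0) = 56 := by
  decide +kernel

theorem nodup_map_cons_flatMap {A : List ℤ} (hA : A.Nodup) {F : ℤ → List (List ℤ)}
    (hF : ∀ a, (F a).Nodup) : (A.flatMap fun a => (F a).map (List.cons a)).Nodup := by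
  refine List.nodup_flatMap.2 ⟨fun a _ => (hF a).map List.cons_injective, hA.imp ?_⟩
  intro a b hab l h1 h2
  obtain ⟨x, -, rfl⟩ := List.mem_map.1 h1
  obtain ⟨y, -, hy⟩ := List.mem_map.1 h2
  exact hab (List.cons.inj hy).1.symm

theorem nodup_boundedLists (n : ℕ) (s q : ℤ) : (boundedLists n s q).Nodup := by
  induction n generalizing s q with
  | zero => unfold boundedLists; split_ifs <;> simp
  | succ n ih =>
    unfold boundedLists
    split_ifs
    · exact nodup_map_cons_flatMap (by decide) fun a => ih _ _
    · exact List.nodup_nil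

theorem nodup_negLists : negLists.Nodup :=
  nodup_map_cons_flatMap (by decide) fun _ => nodup_boundedLists _ _ _

theorem ofFn_mem_boundedLists {n : ℕ} {s q : ℤ} {x : Fin n → ℤ} :
    List.ofFn x ∈ boundedLists n s q ↔
      (∀ i, x i ∈ Set.Icc (-3 : ℤ) 1) ∧ ∑ i, x i = s ∧ ∑ i, x i * x i = q := by
  induction n generalizing s q with
  | zero => simp [boundedLists, eq_comm]
  | succ n ih =>
    have key : List.ofFn x ∈ ([-3, -2, -1, 0, 1] : List ℤ).flatMap (fun a =>
        (boundedLists n (s - a) (q - a * a)).map (List.cons a)) ↔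
        (∀ i, x i ∈ Set.Icc (-3 : ℤ) 1) ∧ ∑ i, x i = s ∧ ∑ i, x i * x i = q := by
      rw [List.mem_flatMap]
      have hx : x 0 ∈ ([-3, -2, -1, 0, 1] : List ℤ) ↔ x 0 ∈ Set.Icc (-3 : ℤ) 1 := by
        simp only [List.mem_cons, List.not_mem_nil, or_false, Set.mem_Icc]; omega
      simp only [List.mem_map, List.ofFn_succ, List.cons.injEq, Fin.sum_univ_succ,
        Fin.forall_fin_succ, ← hx]
      constructor
      · rintro ⟨a, ha, l, hl, rfl, rfl⟩
        obtain ⟨h1, h2, h3⟩ := ih.1 hl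
        exact ⟨⟨ha, h1⟩, by omega, by linarith⟩
      · rintro ⟨⟨ha, h1⟩, h2, h3⟩
        exact ⟨x 0, ha, _, ih.2 ⟨h1, by omega, by linarith⟩, rfl, rfl⟩
    unfold boundedLists
    split_ifs with h
    · exact key
    · refine iff_of_false List.not_mem_nil fun ⟨_, h1, h2⟩ => h ?_
      have := sq_sum_le_card_mul_sum_sq (s := Finset.univ) (f := x)
      simp only [Finset.card_univ, Fintype.card_fin, sq, h1, h2] at this
      exact_mod_cast this

theorem exists_ofFn_eq_of_mem_boundedLists {n : ℕ} {s q : ℤ} {l : List ℤ}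
    (h : l ∈ boundedLists n s q) : ∃ x : Fin n → ℤ, List.ofFn x = l := by
  suffices hl : l.length = n by subst hl; exact ⟨l.get, List.ofFn_get l⟩
  induction n generalizing s q l with
  | zero => unfold boundedLists at h; split_ifs at h <;> simp_all
  | succ n ih =>
    unfold boundedLists at h
    split_ifs at h
    · obtain ⟨a, -, h⟩ := List.mem_flatMap.1 h
      obtain ⟨m, hm, rfl⟩ := List.mem_map.1 h
      simp [ih hm]
    · simp at h

theorem exists_ofFn_eq_of_mem_negLists {l : List ℤ} (h : l ∈ negLists) :
    ∃ D : Fin 9 → ℤ, List.ofFn D = l := by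
  obtain ⟨d, -, h⟩ := List.mem_flatMap.1 h
  obtain ⟨m, hm, rfl⟩ := List.mem_map.1 h
  obtain ⟨x, rfl⟩ := exists_ofFn_eq_of_mem_boundedLists hm
  exact ⟨Fin.cons d x, by simp [List.ofFn_succ]⟩

theorem isNegClass_iff {D : Fin 9 → ℤ} :
    isNegClass D ↔ ∑ i : Fin 8, D i.succ = 1 - 3 * D 0 ∧
      ∑ i : Fin 8, D i.succ * D i.succ = D 0 * D 0 + 1 := by
  simp only [isNegClass, dot, K, Fin.succ_ne_zero, if_true, if_false, mul_one]
  constructor <;> rintro ⟨h1, h2⟩ <;> constructor <;> linarith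

theorem isNegClass.le_and_le {D : Fin 9 → ℤ} (h : isNegClass D) : -1 ≤ D 0 ∧ D 0 ≤ 7 := by
  obtain ⟨h1, h2⟩ := isNegClass_iff.1 h
  have := sq_sum_le_card_mul_sum_sq (s := Finset.univ) (f := fun i : Fin 8 => D i.succ)
  simp only [Finset.card_univ, Fintype.card_fin, sq, h1, h2] at this
  push_cast at this
  constructor <;> nlinarith

theorem isNegClass.succ_mem_Icc {D : Fin 9 → ℤ} (h : isNegClass D) (i : Fin 8) :
    D i.succ ∈ Set.Icc (-3 : ℤ) 1 := by
  obtain ⟨h1, h2⟩ := isNegClass_iff.1 h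
  have := sq_sum_le_card_mul_sum_sq (s := Finset.univ.erase i) (f := fun i : Fin 8 => D i.succ)
  rw [← Finset.add_sum_erase _ _ (Finset.mem_univ i)] at h1 h2
  simp only [Finset.card_erase_of_mem (Finset.mem_univ i), Finset.card_univ, Fintype.card_fin, sq,
    eq_sub_of_add_eq' h1, eq_sub_of_add_eq' h2] at this
  push_cast at this
  have key : (D i.succ + 3) * (D i.succ - 1) ≤ 0 := by
    nlinarith [sq_nonneg (2 * D 0 + 3 * D i.succ - 3)]
  constructor <;> nlinarith

theorem ofFn_mem_negLists {D : Fin 9 → ℤ} : List.ofFn D ∈ negLists ↔ isNegClass D := by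
  have hD : List.ofFn D = D 0 :: List.ofFn fun i : Fin 8 => D i.succ := List.ofFn_succ
  rw [negLists, List.mem_flatMap, hD]
  constructor
  · rintro ⟨d, -, h⟩
    obtain ⟨m, hm, he⟩ := List.mem_map.1 h
    obtain ⟨rfl, rfl⟩ := List.cons.inj he
    exact isNegClass_iff.2 (ofFn_mem_boundedLists.1 hm).2
  · intro h
    refine ⟨D 0, ?_, List.mem_map.2 ⟨_, ofFn_mem_boundedLists.2
      ⟨h.succ_mem_Icc, isNegClass_iff.1 h⟩, rfl⟩⟩
    obtain ⟨h1, h2⟩ := h.le_and_le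
    simp only [List.mem_cons, List.not_mem_nil, or_false]
    omega

theorem mulSum_ofFn {n : ℕ} (x y : Fin n → ℤ) :
    mulSum (List.ofFn x) (List.ofFn y) = ∑ i, x i * y i := by
  induction n with
  | zero => simp [mulSum]
  | succ n ih => simp [List.ofFn_succ, mulSum, ih, Fin.sum_univ_succ]

theorem listDot_ofFn (x y : Fin 9 → ℤ) : listDot (List.ofFn x) (List.ofFn y) = dot x y := by
  rw [List.ofFn_succ, List.ofFn_succ (f := y), listDot, mulSum_ofFn, dot]

theorem ncard_isNegClass_and (P : List ℤ → Bool) :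
    {D | isNegClass D ∧ P (List.ofFn D)}.ncard = negLists.countP P := by
  rw [← Set.ncard_image_of_injective _ (List.ofFn_injective (n := 9)), List.countP_eq_length_filter,
    ← List.toFinset_card_of_nodup (nodup_negLists.filter P), ← Set.ncard_coe_finset]
  congr 1
  ext l
  simp only [Set.mem_image, Set.mem_ofPred_eq, List.coe_toFinset, List.mem_filter]
  constructor
  · rintro ⟨D, ⟨h, hP⟩, rfl⟩
    exact ⟨ofFn_mem_negLists.2 h, hP⟩
  · rintro ⟨h, hP⟩
    obtain ⟨D, rfl⟩ := exists_ofFn_eq_of_mem_negLists h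
    exact ⟨D, ⟨ofFn_mem_negLists.1 h, hP⟩, rfl⟩

theorem ncard_isNegClass : {D | isNegClass D}.ncard = 240 := by
  simpa [length_negLists] using ncard_isNegClass_and fun _ => true

/-- The permutation action on the exceptional coordinates. -/
def permExc (σ : Equiv.Perm (Fin 8)) (D : Fin 9 → ℤ) : Fin 9 → ℤ :=
  Fin.cons (D 0) fun i => D (σ i).succ

theorem permExc_symm_permExc (σ : Equiv.Perm (Fin 8)) (D : Fin 9 → ℤ) :
    permExc σ.symm (permExc σ D) = D := by
  ext i
  refine Fin.cases ?_ (fun j => ?_) i <;> simp [permExc]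

theorem permExc_permExc_symm (σ : Equiv.Perm (Fin 8)) (D : Fin 9 → ℤ) :
    permExc σ (permExc σ.symm D) = D :=
  permExc_symm_permExc σ.symm D

theorem dot_permExc (σ : Equiv.Perm (Fin 8)) (x y : Fin 9 → ℤ) :
    dot (permExc σ x) (permExc σ y) = dot x y := by
  simp only [dot, permExc, Fin.cons_zero, Fin.cons_succ]
  rw [Equiv.sum_comp σ fun i => x i.succ * y i.succ]

theorem permExc_K (σ : Equiv.Perm (Fin 8)) : permExc σ K = K := by
  ext i
  refine Fin.cases ?_ (fun j => ?_) i <;> simp [permExc, K]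

theorem isNegClass_permExc {σ : Equiv.Perm (Fin 8)} {D : Fin 9 → ℤ} :
    isNegClass (permExc σ D) ↔ isNegClass D := by
  rw [isNegClass, isNegClass, dot_permExc]
  nth_rw 1 [← permExc_K σ]
  rw [dot_permExc]

theorem ncard_isNegClass_dot_eq_zero {D : Fin 9 → ℤ} (hD : isNegClass D) :
    {E | isNegClass E ∧ dot D E = 0}.ncard = 56 := by
  set σ := Tuple.sort fun i : Fin 8 => D i.succ
  have hσ : Monotone fun i => D (σ i).succ := Tuple.monotone_sort fun i : Fin 8 => D i.succ
  have hinj : Function.Injective (permExc σ) :=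
    Function.LeftInverse.injective (permExc_symm_permExc σ)
  have himage : permExc σ '' {E | isNegClass E ∧ dot D E = 0} =
      {E | isNegClass E ∧ decide (listDot (List.ofFn (permExc σ D)) (List.ofFn E) = 0)} := by
    ext E
    simp only [Set.mem_image, Set.mem_ofPred_eq, listDot_ofFn, decide_eq_true_eq]
    constructor
    · rintro ⟨E, ⟨hE, h⟩, rfl⟩
      exact ⟨isNegClass_permExc.2 hE, by rwa [dot_permExc]⟩
    · rintro ⟨hE, h⟩
      rw [← permExc_permExc_symm σ E] at hE h
      exact ⟨_, ⟨isNegClass_permExc.1 hE, by rwa [dot_permExc] at h⟩, permExc_permExc_symm σ E⟩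
  rw [← Set.ncard_image_of_injective _ hinj, himage,
    ncard_isNegClass_and fun l => decide (listDot (List.ofFn (permExc σ D)) l = 0)]
  refine countP_negLists_of_sorted _ (ofFn_mem_negLists.2 (isNegClass_permExc.2 hD)) ?_
  rw [List.ofFn_succ, List.tail_cons, List.pairwise_ofFn]
  intro i j hij
  simpa [permExc] using hσ hij.le

theorem dot_comm (x y : Fin 9 → ℤ) : dot x y = dot y x := by
  simp only [dot, mul_comm]

theorem dot_add_left (x y z : Fin 9 → ℤ) : dot (x + y) z = dot x z + dot y z := by
  simp only [dot, Pi.add_apply, add_mul, Finset.sum_add_distrib]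
  ring

theorem dot_neg_left (x y : Fin 9 → ℤ) : dot (-x) y = -dot x y := by
  simp only [dot, Pi.neg_apply, neg_mul, Finset.sum_neg_distrib]
  ring

theorem dot_add_right (x y z : Fin 9 → ℤ) : dot x (y + z) = dot x y + dot x z := by
  simp only [dot_comm x, dot_add_left]

theorem dot_neg_right (x y : Fin 9 → ℤ) : dot x (-y) = -dot x y := by
  simp only [dot_comm x, dot_neg_left]

theorem dot_K_K : dot K K = 1 := by decide

theorem isNegClass.K_add_add {D E : Fin 9 → ℤ} (hD : isNegClass D) (hE : isNegClass E)
    (h : dot D E = 2) : isNegClass (K + (D + E)) := by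
  simp only [isNegClass, dot_add_left, dot_add_right, dot_K_K, dot_comm K, dot_comm E D, hD.1, hD.2,
    hE.1, hE.2, h]
  norm_num

theorem isNegClass.neg_K_add_sub_iff {D E : Fin 9 → ℤ} (hD : isNegClass D) (hE : isNegClass E) :
    isNegClass (-K + D - E) ↔ dot D E = 0 := by
  simp only [isNegClass, sub_eq_add_neg, dot_add_left, dot_add_right, dot_neg_left, dot_neg_right,
    dot_K_K, dot_comm K, dot_comm E D, hD.1, hD.2, hE.1, hE.2]
  omega

theorem isTwoRuling_iff {R : Fin 9 → ℤ} : IsTwoRuling R ↔ ∃ D, isNegClass D ∧ R = -K + D := by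
  constructor
  · rintro ⟨D, E, hD, hE, h, rfl⟩
    exact ⟨_, hD.K_add_add hE h, by abel⟩
  · rintro ⟨D, hD, rfl⟩
    obtain ⟨E, hE, h⟩ := Set.nonempty_of_ncard_ne_zero
      (by rw [ncard_isNegClass_dot_eq_zero hD]; norm_num :
        {E | isNegClass E ∧ dot D E = 0}.ncard ≠ 0)
    refine ⟨E, -K + D - E, hE, (hD.neg_K_add_sub_iff hE).2 h, ?_, by abel⟩
    simp only [sub_eq_add_neg, dot_add_right, dot_neg_right, dot_comm E D, hE.1, hE.2, h]
    norm_num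

/-- If `S` is closed under the fixed-point-free involution `x ↦ R - x`, then the pairs in `S` with
sum `R` partition `S`. -/
theorem two_mul_ncard_pairs {G : Type*} [AddCommGroup G] [DecidableEq G] {S : Finset G} {R : G}
    (hS : ∀ x ∈ S, R - x ∈ S) (hne : ∀ x ∈ S, x ≠ R - x) :
    2 * {p : Finset G | p.card = 2 ∧ (∀ x ∈ p, x ∈ S) ∧ ∑ x ∈ p, x = R}.ncard = S.card := by
  have himage : {p : Finset G | p.card = 2 ∧ (∀ x ∈ p, x ∈ S) ∧ ∑ x ∈ p, x = R} =
      ↑(S.image fun x => ({x, R - x} : Finset G)) := by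
    ext p
    simp only [Set.mem_ofPred_eq, Finset.coe_image, Set.mem_image, Finset.mem_coe]
    constructor
    · rintro ⟨hp, hpS, rfl⟩
      obtain ⟨x, y, hxy, rfl⟩ := Finset.card_eq_two.1 hp
      exact ⟨x, hpS x (by simp), by simp [Finset.sum_pair hxy]⟩
    · rintro ⟨x, hx, rfl⟩
      refine ⟨Finset.card_pair (hne x hx), ?_, by rw [Finset.sum_pair (hne x hx)]; abel⟩
      simpa using ⟨hx, hS x hx⟩
  rw [himage, Set.ncard_coe_finset,
    Finset.card_eq_sum_card_image (fun x => ({x, R - x} : Finset G)) S,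
    Finset.sum_const_nat (m := 2), mul_comm]
  intro p hp
  obtain ⟨x, hx, rfl⟩ := Finset.mem_image.1 hp
  rw [← Finset.card_pair (hne x hx)]
  congr 1
  ext y
  simp only [Finset.mem_filter, Finset.mem_insert, Finset.mem_singleton]
  constructor
  · rintro ⟨-, h⟩
    have : y ∈ ({y, R - y} : Finset G) := by simp
    simpa [h] using this
  · rintro (rfl | rfl)
    · exact ⟨hx, rfl⟩
    · exact ⟨hS x hx, by rw [sub_sub_cancel, Finset.pair_comm]⟩

theorem ncard_pairs_of_isTwoRuling {R : Fin 9 → ℤ} (hR : IsTwoRuling R) :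
    {p : Finset (Fin 9 → ℤ) | p.card = 2 ∧ (∀ x ∈ p, isNegClass x) ∧
      ∑ x ∈ p, x = R}.ncard = 28 := by
  obtain ⟨D, hD, rfl⟩ := isTwoRuling_iff.1 hR
  have hcard := ncard_isNegClass_dot_eq_zero hD
  have hfin : {E | isNegClass E ∧ dot D E = 0}.Finite :=
    Set.finite_of_ncard_ne_zero (by rw [hcard]; norm_num)
  have hmem (x) : x ∈ hfin.toFinset ↔ isNegClass x ∧ isNegClass (-K + D - x) := by
    rw [Set.Finite.mem_toFinset, Set.mem_ofPred_eq]
    exact and_congr_right fun hx => (hD.neg_K_add_sub_iff hx).symm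
  have hpairs := two_mul_ncard_pairs (S := hfin.toFinset) (R := -K + D)
    (fun x hx => by
      rw [hmem] at hx ⊢
      exact ⟨hx.2, by rw [sub_sub_cancel]; exact hx.1⟩)
    (fun x hx h => by
      rw [Set.Finite.mem_toFinset] at hx
      have h2 : x + x = -K + D := eq_sub_iff_add_eq.1 h
      have := congrArg (dot D) h2
      simp only [dot_add_right, dot_neg_right, hx.2, hD.1, hD.2] at this
      have h3 := congrArg (fun y => dot y y) h2
      simp only [dot_add_left, dot_add_right, dot_neg_left, dot_neg_right, dot_comm K, dot_K_K,
        hx.1.1, hD.1, hD.2] at h3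
      omega)
  rw [← Set.ncard_eq_toFinset_card _ hfin, hcard] at hpairs
  suffices hset : {p : Finset (Fin 9 → ℤ) | p.card = 2 ∧ (∀ x ∈ p, isNegClass x) ∧
      ∑ x ∈ p, x = -K + D} =
      {p | p.card = 2 ∧ (∀ x ∈ p, x ∈ hfin.toFinset) ∧ ∑ x ∈ p, x = -K + D} by
    rw [hset]
    omega
  ext p
  refine and_congr_right fun hp => and_congr_left fun hsum => ?_
  refine ⟨fun h x hx => (hmem x).2 ⟨h x hx, ?_⟩, fun h x hx => ((hmem x).1 (h x hx)).1⟩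
  rw [← hsum, ← Finset.add_sum_erase p (fun x => x) hx, add_sub_cancel_left]
  obtain ⟨y, hy⟩ := Finset.card_eq_one.1 (by rw [Finset.card_erase_of_mem hx, hp] :
    (p.erase x).card = 1)
  rw [hy, Finset.sum_singleton]
  exact h y (Finset.mem_of_mem_erase (hy ▸ Finset.mem_singleton_self y))

theorem stmt15 :
    {R : Fin 9 → ℤ | IsTwoRuling R}.ncard = 240 ∧
    {R : Fin 9 → ℤ | IsTwoRuling R} = {R | ∃ D, isNegClass D ∧ R = -K + D} ∧
    ∀ R : Fin 9 → ℤ, IsTwoRuling R →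
      {p : Finset (Fin 9 → ℤ) | p.card = 2 ∧ (∀ x ∈ p, isNegClass x) ∧
        ∑ x ∈ p, x = R}.ncard = 28 := by
  have hset : {R : Fin 9 → ℤ | IsTwoRuling R} = {R | ∃ D, isNegClass D ∧ R = -K + D} :=
    Set.ext fun _ => isTwoRuling_iff
  refine ⟨?_, hset, fun R => ncard_pairs_of_isTwoRuling⟩
  rw [hset, ← ncard_isNegClass,
    ← Set.ncard_image_of_injective {D | isNegClass D} (add_right_injective (-K))]
  congr 1
  ext R
  exact exists_congr fun D => and_congr_right fun _ => eq_comm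
end

section
/- In Pic(S_8) ≅ ℤ^9, the class -2K is the unique (3)-ruling: it is the unique class expressible as D_1 + D_2 with D_1, D_2 (-1)-classes and D_1·D_2 = 3, and the pairs realizing it are exactly {D, -2K - D} where D ranges over (-1)-classes, giving 120 unordered pairs. -/
open Finset

theorem dot_sub_left (x y z : Fin 9 → ℤ) : dot (x - y) z = dot x z - dot y z := by
  rw [sub_eq_add_neg, dot_add_left, dot_neg_left, sub_eq_add_neg]

theorem dot_sub_right (x y z : Fin 9 → ℤ) : dot x (y - z) = dot x y - dot x z := by
  rw [sub_eq_add_neg, dot_add_right, dot_neg_right, sub_eq_add_neg]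

theorem dot_K_right (x : Fin 9 → ℤ) : dot x K = -3 * x 0 - ∑ i : Fin 8, x i.succ := by
  simp [dot, K, Fin.succ_ne_zero, mul_comm]

theorem dot_self (x : Fin 9 → ℤ) : dot x x = x 0 ^ 2 - ∑ i : Fin 8, x i.succ ^ 2 := by
  simp [dot, sq]

/-- The orthogonal complement of `K` is negative definite, with an explicit bound. -/
theorem sq_le_of_dot_K_eq_zero {v : Fin 9 → ℤ} (h : dot v K = 0) :
    v 0 ^ 2 ≤ -8 * dot v v := by
  have hc := sq_sum_le_card_mul_sum_sq (s := univ) (f := fun i : Fin 8 => v i.succ)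
  rw [dot_K_right] at h
  rw [dot_self]
  have hs : ∑ i : Fin 8, v i.succ = -3 * v 0 := by linarith
  rw [hs] at hc
  simp only [card_univ, Fintype.card_fin] at hc
  push_cast at hc
  linarith

theorem eq_zero_of_dot_K_eq_zero {v : Fin 9 → ℤ} (hK : dot v K = 0) (hv : dot v v = 0) :
    v = 0 := by
  have h0 : v 0 = 0 := by
    have := sq_le_of_dot_K_eq_zero hK
    rw [hv] at this
    exact pow_eq_zero_iff two_ne_zero |>.mp (le_antisymm (by simpa using this) (sq_nonneg _))
  rw [dot_self, h0] at hv
  have hs : ∑ i : Fin 8, v i.succ ^ 2 = 0 := by linarith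
  rw [sum_eq_zero_iff_of_nonneg fun _ _ => sq_nonneg _] at hs
  funext i
  cases i using Fin.cases with
  | zero => exact h0
  | succ j => simpa using hs j (mem_univ j)

theorem add_eq_neg_two_K {D E : Fin 9 → ℤ} (hD : isNegClass D) (hE : isNegClass E)
    (h : dot D E = 3) : D + E = -(2 • K) := by
  rw [eq_neg_iff_add_eq_zero]
  apply eq_zero_of_dot_K_eq_zero <;>
  · simp only [two_nsmul, dot_add_left, dot_add_right, dot_K_K, hD.1, hD.2, hE.1, hE.2, h,
      dot_comm E D, dot_comm K D, dot_comm K E]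
    norm_num

theorem isNegClass.compl {D : Fin 9 → ℤ} (hD : isNegClass D) :
    isNegClass (-(2 • K) - D) := by
  constructor <;>
  · simp only [two_nsmul, dot_sub_left, dot_sub_right, dot_neg_left, dot_neg_right, dot_add_left,
      dot_add_right, dot_K_K, hD.1, hD.2, dot_comm K D]
    norm_num

theorem isNegClass.dot_compl {D : Fin 9 → ℤ} (hD : isNegClass D) :
    dot D (-(2 • K) - D) = 3 := by
  simp only [two_nsmul, dot_sub_right, dot_neg_right, dot_add_right, hD.1, hD.2]
  norm_num

theorem isNegClass.ne_compl {D : Fin 9 → ℤ} (hD : isNegClass D) : D ≠ -(2 • K) - D := by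
  intro h
  have := hD.dot_compl
  rw [← h, hD.1] at this
  norm_num at this

theorem exists_isNegClass : ∃ D, isNegClass D :=
  ⟨Pi.single 1 1, by unfold isNegClass; decide⟩

/-- The vectors of length `n` with entries in `[-4, 4]`, sum `s` and sum of squares `q`. -/
noncomputable def boxVectors (n : ℕ) (s q : ℤ) : Finset (Fin n → ℤ) :=
  {v ∈ Fintype.piFinset fun _ => Icc (-4) 4 | ∑ i, v i = s ∧ ∑ i, v i ^ 2 = q}

theorem mem_boxVectors {n : ℕ} {s q : ℤ} {v : Fin n → ℤ} :
    v ∈ boxVectors n s q ↔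
      (∀ i, v i ∈ Icc (-4) 4) ∧ ∑ i, v i = s ∧ ∑ i, v i ^ 2 = q := by
  simp [boxVectors]

theorem card_boxVectors_succ (n : ℕ) (s q : ℤ) :
    #(boxVectors (n + 1) s q) = ∑ x ∈ Icc (-4) 4, #(boxVectors n (s - x) (q - x ^ 2)) := by
  rw [← card_sigma]
  refine card_bij' (fun v _ => ⟨v 0, Fin.tail v⟩) (fun p _ => Fin.cons p.1 p.2) ?_ ?_ ?_ ?_
  · intro v hv
    simp only [mem_sigma, mem_boxVectors, Fin.sum_univ_succ, Fin.tail] at hv ⊢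
    exact ⟨hv.1 0, fun i => hv.1 i.succ, by linarith [hv.2.1], by linarith [hv.2.2]⟩
  · rintro ⟨x, v⟩ hv
    simp only [mem_sigma, mem_boxVectors, Fin.sum_univ_succ, Fin.forall_fin_succ, Fin.cons_zero,
      Fin.cons_succ] at hv ⊢
    exact ⟨⟨hv.1, hv.2.1⟩, by linarith [hv.2.2.1], by linarith [hv.2.2.2]⟩
  · intro v _
    exact Fin.cons_self_tail v
  · rintro ⟨x, v⟩ _
    simp

theorem boxVectors_eq_empty {n : ℕ} {s q : ℤ} (h : n * q < s ^ 2) : boxVectors n s q = ∅ := by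
  rw [eq_empty_iff_forall_notMem]
  intro v hv
  obtain ⟨-, rfl, rfl⟩ := mem_boxVectors.mp hv
  have := sq_sum_le_card_mul_sum_sq (s := univ) (f := v)
  rw [card_univ, Fintype.card_fin] at this
  exact absurd h this.not_gt

/-- A recursive count of `boxVectors`, pruned by the Cauchy-Schwarz inequality. -/
def boxCount : ℕ → ℤ → ℤ → ℕ
  | 0, s, q => if s = 0 ∧ q = 0 then 1 else 0
  | n + 1, s, q =>
    if (n + 1 : ℕ) * q < s ^ 2 then 0
    else ([-4, -3, -2, -1, 0, 1, 2, 3, 4].map fun x => boxCount n (s - x) (q - x ^ 2)).sum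

theorem card_boxVectors (n : ℕ) (s q : ℤ) : #(boxVectors n s q) = boxCount n s q := by
  induction n generalizing s q with
  | zero =>
    by_cases h : s = 0 ∧ q = 0
    · simp [boxVectors, boxCount, h]
    · rw [boxCount, if_neg h, card_eq_zero, eq_empty_iff_forall_notMem]
      intro v hv
      obtain ⟨-, rfl, rfl⟩ := mem_boxVectors.mp hv
      simp at h
  | succ n ih =>
    rw [boxCount]
    split_ifs with h
    · rw [boxVectors_eq_empty h, card_empty]
    · rw [card_boxVectors_succ]
      simp only [ih]
      rfl

/-- The pairs `(c, y)` describing the vectors of square `-2` orthogonal to `K`. -/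
noncomputable def rootData : Finset (Σ _ : ℤ, Fin 8 → ℤ) :=
  (Icc (-4) 4).sigma fun c => boxVectors 8 (-3 * c) (c ^ 2 + 2)

theorem card_rootData : #rootData = 240 := by
  rw [rootData, card_sigma]
  simp only [card_boxVectors]
  decide +kernel

theorem mem_rootData {v : Fin 9 → ℤ} :
    (⟨v 0, Fin.tail v⟩ : Σ _ : ℤ, Fin 8 → ℤ) ∈ rootData ↔ dot v K = 0 ∧ dot v v = -2 := by
  simp only [rootData, mem_sigma, mem_boxVectors, dot_K_right, dot_self, Fin.tail]
  constructor
  · rintro ⟨-, -, hs, hq⟩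
    exact ⟨by linarith, by linarith⟩
  · rintro ⟨hs, hq⟩
    have h0 : v 0 ^ 2 ≤ 16 := by
      have := sq_le_of_dot_K_eq_zero ((dot_K_right v).trans hs)
      rw [dot_self, hq] at this
      linarith
    have hi (i : Fin 8) : v i.succ ^ 2 ≤ 18 := by
      have := single_le_sum (f := fun i : Fin 8 => v i.succ ^ 2)
        (fun _ _ => sq_nonneg _) (mem_univ i)
      linarith
    refine ⟨?_, fun i => ?_, by linarith, by linarith⟩
    · rw [mem_Icc]
      constructor <;> nlinarith
    · have := hi i
      rw [mem_Icc]
      constructor <;> nlinarith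

theorem isNegClass_sub_K_iff {v : Fin 9 → ℤ} :
    isNegClass (v - K) ↔ dot v K = 0 ∧ dot v v = -2 := by
  simp only [isNegClass, dot_sub_left, dot_sub_right, dot_K_K, dot_comm K v]
  constructor <;> rintro ⟨h₁, h₂⟩ <;> constructor <;> linarith

/-- The finite set of all `(-1)`-classes. -/
noncomputable def negClasses : Finset (Fin 9 → ℤ) :=
  rootData.image fun p => Fin.cons p.1 p.2 - K

theorem mem_negClasses {D : Fin 9 → ℤ} : D ∈ negClasses ↔ isNegClass D := by
  rw [negClasses, mem_image]
  constructor
  · rintro ⟨⟨c, y⟩, h, rfl⟩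
    rw [isNegClass_sub_K_iff, ← mem_rootData]
    simpa using h
  · intro h
    refine ⟨⟨(D + K) 0, Fin.tail (D + K)⟩, ?_, ?_⟩
    · rw [mem_rootData, ← isNegClass_sub_K_iff]
      simpa using h
    · rw [Fin.cons_self_tail, add_sub_cancel_right]

theorem card_negClasses : #negClasses = 240 := by
  rw [negClasses, card_image_of_injective, card_rootData]
  rintro ⟨c, y⟩ ⟨d, z⟩ h
  obtain ⟨rfl, rfl⟩ := Fin.cons_inj.mp (sub_left_injective h)
  rfl

theorem pair_compl_eq_iff {D E : Fin 9 → ℤ} :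
    ({E, -(2 • K) - E} : Finset (Fin 9 → ℤ)) = {D, -(2 • K) - D} ↔
      E ∈ ({D, -(2 • K) - D} : Finset (Fin 9 → ℤ)) := by
  constructor
  · intro h
    exact h ▸ mem_insert_self _ _
  · intro h
    rcases mem_insert.mp h with rfl | h
    · rfl
    · rw [mem_singleton.mp h, sub_sub_cancel, pair_comm]

theorem card_image_pair_compl :
    #(negClasses.image fun D => ({D, -(2 • K) - D} : Finset (Fin 9 → ℤ))) = 120 := by
  have h := card_eq_sum_card_image
    (fun D => ({D, -(2 • K) - D} : Finset (Fin 9 → ℤ))) negClasses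
  rw [card_negClasses, sum_const_nat (m := 2)] at h
  · omega
  · intro p hp
    obtain ⟨D, hD, rfl⟩ := mem_image.mp hp
    rw [mem_negClasses] at hD
    refine Eq.trans (congrArg card ?_) (card_pair hD.ne_compl)
    ext E
    rw [mem_filter, pair_compl_eq_iff, mem_negClasses, and_iff_right_iff_imp]
    intro hE
    rcases mem_insert.mp hE with rfl | hE
    · exact hD
    · rw [mem_singleton.mp hE]
      exact hD.compl

theorem setOf_pairs_eq :
    {p : Finset (Fin 9 → ℤ) | p.card = 2 ∧ (∀ x ∈ p, isNegClass x) ∧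
      (∀ x ∈ p, ∀ y ∈ p, x ≠ y → dot x y = 3) ∧ ∑ x ∈ p, x = -(2 • K)}
      = {p | ∃ D, isNegClass D ∧ p = {D, -(2 • K) - D}} := by
  ext p
  simp only [Set.mem_ofPred_eq]
  constructor
  · rintro ⟨hp, hneg, -, hsum⟩
    obtain ⟨D, E, hne, rfl⟩ := card_eq_two.mp hp
    rw [sum_pair hne] at hsum
    exact ⟨D, hneg D (by simp), by rw [← hsum, add_sub_cancel_left]⟩
  · rintro ⟨D, hD, rfl⟩
    refine ⟨card_pair hD.ne_compl, ?_, ?_, ?_⟩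
    · simp only [mem_insert, mem_singleton, forall_eq_or_imp, forall_eq]
      exact ⟨hD, hD.compl⟩
    · simp only [mem_insert, mem_singleton, forall_eq_or_imp, forall_eq]
      exact ⟨⟨fun h => absurd rfl h, fun _ => hD.dot_compl⟩,
        fun _ => (dot_comm _ _).trans hD.dot_compl, fun h => absurd rfl h⟩
    · rw [sum_pair hD.ne_compl, add_sub_cancel]

theorem stmt16 :
    {R : Fin 9 → ℤ | ∃ D1 D2, isNegClass D1 ∧ isNegClass D2 ∧ dot D1 D2 = 3 ∧
      R = D1 + D2} = {-(2 • K)} ∧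
    {p : Finset (Fin 9 → ℤ) | p.card = 2 ∧ (∀ x ∈ p, isNegClass x) ∧
      (∀ x ∈ p, ∀ y ∈ p, x ≠ y → dot x y = 3) ∧ ∑ x ∈ p, x = -(2 • K)}
      = {p | ∃ D, isNegClass D ∧ p = {D, -(2 • K) - D}} ∧
    {p : Finset (Fin 9 → ℤ) | p.card = 2 ∧ (∀ x ∈ p, isNegClass x) ∧
      (∀ x ∈ p, ∀ y ∈ p, x ≠ y → dot x y = 3) ∧ ∑ x ∈ p, x = -(2 • K)}.ncard
      = 120 := by
  refine ⟨?_, setOf_pairs_eq, ?_⟩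
  · ext R
    rw [Set.mem_ofPred_eq, Set.mem_singleton_iff]
    constructor
    · rintro ⟨D, E, hD, hE, h, rfl⟩
      exact add_eq_neg_two_K hD hE h
    · rintro rfl
      obtain ⟨D, hD⟩ := exists_isNegClass
      exact ⟨D, _, hD, hD.compl, hD.dot_compl, (add_sub_cancel _ _).symm⟩
  · rw [setOf_pairs_eq, ← card_image_pair_compl, ← Set.ncard_coe_finset]
    congr 1
    ext p
    simp [mem_negClasses, eq_comm]
end
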